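/- Assume n ≥ 2 and let v ∈ V. The evaluation map ev_v : H*(GQ_{2n−1}) → R, f ↦ f(v), is a surjective ring homomorphism whose kernel equals the ideal of H*(GQ_{2n−1}) generated by M_v together with all Δ_P for nonempty independent P ⊆ V with v ∉ P. Consequently, the quotient of H*(GQ_{2n−1}) by this ideal is isomorphic as a ring to ℤ[α_1,…,α_n]. -/

import Mathlib

open MvPolynomial Finset

noncomputable section

abbrev Rr (n : ℕ) := MvPolynomial (Fin n) ℤ

/-- The "opposite" vertex: 0-indexed version of i ↦ 2n+1−i. -/
def bar {n : ℕ} (i : Fin (2*n)) : Fin (2*n) :=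
  ⟨2*n - 1 - i.val, by have := i.isLt; omega⟩

/-- The weight α_i (0-indexed): α_i = X i for i < n, and α_i = −α_{bar i} otherwise. -/
def av {n : ℕ} (i : Fin (2*n)) : Rr n :=
  if h : i.val < n then X ⟨i.val, h⟩
  else - X ⟨2*n - 1 - i.val, by have := i.isLt; omega⟩

/-- The axial function α(ij). -/
def ax {n : ℕ} (i j : Fin (2*n)) : Rr n :=
  if j = bar i then - av i else - av i + av j

/-- The class M_v. -/
def Mv {n : ℕ} (v : Fin (2*n)) : Fin (2*n) → Rr n := fun j =>
  if j = v then 0 else if j = bar v then 2 * av v else - av j + av v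

/-- The class Q. -/
def Qf {n : ℕ} : Fin (2*n) → Rr n := fun j => - av j

/-- Independence: K contains no pair {i, bar i}. -/
def indep {n : ℕ} (K : Finset (Fin (2*n))) : Prop :=
  ∀ i : Fin (2*n), ¬ ({i, bar i} : Finset (Fin (2*n))) ⊆ K

/-- The class Δ_K. -/
def Del {n : ℕ} (K : Finset (Fin (2*n))) : Fin (2*n) → Rr n := fun j =>
  if j ∈ K then ∏ k ∈ Kᶜ, ax j k else 0

/-- The class Δ'_K. -/
def Del' {n : ℕ} (K : Finset (Fin (2*n))) : Fin (2*n) → Rr n := fun j =>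
  if j ∈ K then ∏ k ∈ (K ∪ {bar j})ᶜ, ax j k else 0

/-- The graph equivariant cohomology H*(GQ_{2n−1}) as a subring of the ring of
functions V → R with pointwise operations. -/
def HGQ (n : ℕ) : Subring (Fin (2*n) → Rr n) where
  carrier := {f | ∀ i j : Fin (2*n), i ≠ j → ax i j ∣ f i - f j}
  zero_mem' := fun i j _ => by simp
  one_mem' := fun i j _ => by simp
  add_mem' := by
    intro a b ha hb i j h
    have e : (a + b) i - (a + b) j = (a i - a j) + (b i - b j) := by
      simp only [Pi.add_apply]; ring
    rw [e]; exact dvd_add (ha i j h) (hb i j h)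
  neg_mem' := by
    intro a ha i j h
    have e : (-a) i - (-a) j = -(a i - a j) := by
      simp only [Pi.neg_apply]; ring
    rw [e]; exact dvd_neg.mpr (ha i j h)
  mul_mem' := by
    intro a b ha hb i j h
    have e : (a * b) i - (a * b) j = a i * (b i - b j) + (a i - a j) * b j := by
      simp only [Pi.mul_apply]; ring
    rw [e]; exact dvd_add ((hb i j h).mul_left _) ((ha i j h).mul_right _)

/-- The graph equivariant cohomology H*(GQ_{2n−2}) (edges i j with j ≠ bar i only). -/
def HGQe (n : ℕ) : Subring (Fin (2*n) → Rr n) where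
  carrier := {f | ∀ i j : Fin (2*n), i ≠ j → j ≠ bar i → ax i j ∣ f i - f j}
  zero_mem' := fun i j _ _ => by simp
  one_mem' := fun i j _ _ => by simp
  add_mem' := by
    intro a b ha hb i j h h'
    have e : (a + b) i - (a + b) j = (a i - a j) + (b i - b j) := by
      simp only [Pi.add_apply]; ring
    rw [e]; exact dvd_add (ha i j h h') (hb i j h h')
  neg_mem' := by
    intro a ha i j h h'
    have e : (-a) i - (-a) j = -(a i - a j) := by
      simp only [Pi.neg_apply]; ring
    rw [e]; exact dvd_neg.mpr (ha i j h h')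
  mul_mem' := by
    intro a b ha hb i j h h'
    have e : (a * b) i - (a * b) j = a i * (b i - b j) + (a i - a j) * b j := by
      simp only [Pi.mul_apply]; ring
    rw [e]; exact dvd_add ((hb i j h h').mul_left _) ((ha i j h h').mul_right _)


/-- The evaluation map ev_v : H*(GQ_{2n−1}) → R, f ↦ f(v), as a ring homomorphism. -/
def evRing (n : ℕ) (v : Fin (2*n)) : HGQ n →+* Rr n :=
  (Pi.evalRingHom (fun _ : Fin (2*n) => Rr n) v).comp (HGQ n).subtype

/-- The ideal of H*(GQ_{2n−1}) generated by M_v together with all Δ_P for nonempty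
independent P with v ∉ P. -/
def kerIdeal (n : ℕ) (v : Fin (2*n)) : Ideal (HGQ n) :=
  Ideal.span {g : HGQ n | (g : Fin (2*n) → Rr n) = Mv v ∨
    ∃ P : Finset (Fin (2*n)), P.Nonempty ∧ indep P ∧ v ∉ P ∧
      (g : Fin (2*n) → Rr n) = Del P}

/-- The index in `Fin n` of the variable underlying `av j`. -/
def varIdx {n : ℕ} (j : Fin (2*n)) : Fin n :=
  if h : j.val < n then ⟨j.val, h⟩ else ⟨2*n - 1 - j.val, by have := j.isLt; omega⟩

/-- The sign of `av j`. -/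
def varSign {n : ℕ} (j : Fin (2*n)) : ℤˣ := if j.val < n then 1 else -1

lemma av_eq {n : ℕ} (j : Fin (2*n)) : av j = C (varSign j : ℤ) * X (varIdx j) := by
  unfold av varSign varIdx
  split_ifs <;> simp

lemma bar_bar {n : ℕ} (i : Fin (2*n)) : bar (bar i) = i := by
  have := i.isLt
  ext
  simp only [bar]
  omega

lemma eq_bar_comm {n : ℕ} {i j : Fin (2*n)} : i = bar j ↔ j = bar i := by
  constructor <;> (rintro rfl; rw [bar_bar])

lemma bar_val_lt_iff {n : ℕ} (i : Fin (2*n)) : (bar i).val < n ↔ ¬ i.val < n := by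
  have := i.isLt
  simp only [bar]
  omega

lemma bar_ne {n : ℕ} (i : Fin (2*n)) : bar i ≠ i := by
  intro h
  have := bar_val_lt_iff i
  rw [h] at this
  tauto

lemma varSign_bar {n : ℕ} (i : Fin (2*n)) : varSign (bar i) = - varSign i := by
  unfold varSign
  rw [ite_congr (propext (bar_val_lt_iff i)) (fun _ => rfl) (fun _ => rfl)]
  split_ifs <;> simp_all

lemma varIdx_bar {n : ℕ} (i : Fin (2*n)) : varIdx (bar i) = varIdx i := by
  have := i.isLt
  have hbar : (bar i).val = 2*n - 1 - i.val := rfl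
  unfold varIdx
  split_ifs <;> simp only [Fin.mk.injEq] <;> omega

lemma av_bar {n : ℕ} (i : Fin (2*n)) : av (bar i) = - av i := by
  simp [av_eq, varSign_bar, varIdx_bar]

lemma eq_or_eq_bar_of_varIdx_eq {n : ℕ} {i j : Fin (2*n)} (h : varIdx i = varIdx j) :
    j = i ∨ j = bar i := by
  have := i.isLt
  have := j.isLt
  unfold varIdx at h
  split_ifs at h <;> simp only [bar, Fin.ext_iff] at * <;> omega

lemma Mv_apply {n : ℕ} (v j : Fin (2*n)) : Mv v j = av v - av j := by
  unfold Mv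
  split_ifs with h h'
  · simp [h]
  · rw [h', av_bar]; ring
  · ring

lemma ax_dvd_sub {n : ℕ} (i j : Fin (2*n)) : ax i j ∣ av j - av i := by
  unfold ax
  split_ifs with h
  · rw [h, av_bar]; exact ⟨2, by ring⟩
  · exact ⟨1, by ring⟩

lemma ax_dvd_ax_swap {n : ℕ} (i j : Fin (2*n)) : ax i j ∣ ax j i := by
  unfold ax
  by_cases h : j = bar i
  · rw [if_pos h, if_pos (eq_bar_comm.1 h), h, av_bar, neg_neg]
    exact neg_dvd.2 dvd_rfl
  · rw [if_neg h, if_neg (fun h' => h (eq_bar_comm.1 h'))]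
    exact ⟨-1, by ring⟩

lemma Mv_mem {n : ℕ} (v : Fin (2*n)) : Mv v ∈ HGQ n := by
  intro i j _
  have e : Mv v i - Mv v j = av j - av i := by
    rw [Mv_apply, Mv_apply]; ring
  rw [e]
  exact ax_dvd_sub i j

lemma indep.bar_notMem {n : ℕ} {P : Finset (Fin (2*n))} (hP : indep P) {i : Fin (2*n)}
    (hi : i ∈ P) : bar i ∉ P := fun h => hP i (by simp [Finset.insert_subset_iff, hi, h])

lemma ax_dvd_prod_sub_prod {n : ℕ} {s : Finset (Fin (2*n))} {i j : Fin (2*n)}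
    (hij : j ≠ bar i) (hi : bar i ∈ s) (hj : bar j ∈ s) :
    ax i j ∣ ∏ k ∈ s, ax i k - ∏ k ∈ s, ax j k := by
  by_cases hne : i = j
  · simp [hne]
  have hbne : bar j ≠ bar i := fun h => hne (by rw [← bar_bar i, ← h, bar_bar])
  have hji : bar j ∈ s.erase (bar i) := Finset.mem_erase.2 ⟨hbne, hj⟩
  rw [← Finset.mul_prod_erase s _ hi, ← Finset.mul_prod_erase s (ax j) hi,
    ← Finset.mul_prod_erase _ _ hji, ← Finset.mul_prod_erase _ (ax j) hji]
  have hax : ax i j = av j - av i := by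
    rw [ax, if_neg hij]; ring
  have hpair : ax i (bar i) * ax i (bar j) - ax j (bar i) * ax j (bar j)
      = (av j - av i) * -(av i + av j) := by
    simp only [ax, if_neg hbne, if_neg hbne.symm, av_bar, if_true]
    ring
  have hrest : ax i j ∣ ∏ k ∈ (s.erase (bar i)).erase (bar j), ax i k
      - ∏ k ∈ (s.erase (bar i)).erase (bar j), ax j k := by
    rw [← Ideal.mem_span_singleton, ← Ideal.Quotient.mk_eq_mk_iff_sub_mem, map_prod, map_prod]
    refine Finset.prod_congr rfl fun k hk => ?_
    simp only [Finset.mem_erase] at hk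
    rw [Ideal.Quotient.mk_eq_mk_iff_sub_mem, Ideal.mem_span_singleton, hax]
    simp only [ax, if_neg hk.1, if_neg hk.2.1]
    exact ⟨1, by ring⟩
  have e : ∀ a b c d p q : Rr n,
      a * (b * p) - c * (d * q) = a * b * (p - q) + (a * b - c * d) * q := by
    intros; ring
  rw [e]
  refine dvd_add (hrest.mul_left _) (Dvd.dvd.mul_right ?_ _)
  rw [hpair, hax]
  exact dvd_mul_right _ _

lemma Del_mem {n : ℕ} {P : Finset (Fin (2*n))} (hP : indep P) : Del P ∈ HGQ n := by
  intro i j _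
  by_cases hi : i ∈ P <;> by_cases hj : j ∈ P <;> simp only [Del, hi, hj, if_true, if_false]
  · have hbar : j ≠ bar i := by
      rintro rfl
      exact hP.bar_notMem hi hj
    exact ax_dvd_prod_sub_prod hbar (Finset.mem_compl.2 (hP.bar_notMem hi))
      (Finset.mem_compl.2 (hP.bar_notMem hj))
  · rw [sub_zero]
    exact Finset.dvd_prod_of_mem _ (Finset.mem_compl.2 hj)
  · rw [zero_sub, dvd_neg]
    exact (ax_dvd_ax_swap i j).trans (Finset.dvd_prod_of_mem _ (Finset.mem_compl.2 hi))
  · simp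

lemma irreducible_ax {n : ℕ} {i j : Fin (2*n)} (hij : i ≠ j) : Irreducible (ax i j) := by
  have hu : ∀ k : Fin (2*n), IsUnit (C (varSign k : ℤ) : Rr n) := fun k =>
    (varSign k).isUnit.map C
  unfold ax
  split_ifs with h
  · rw [av_eq, ← neg_mul, irreducible_isUnit_mul (hu i).neg]
    exact X_prime.irreducible
  · have hidx : varIdx i ≠ varIdx j := fun h' =>
      (eq_or_eq_bar_of_varIdx_eq h').elim (fun e => hij e.symm) h
    rw [av_eq, av_eq, add_comm]
    refine irreducible_mul_X_add _ _ _ (hu j).ne_zero (by rw [vars_C]; simp) ?_ (hu j).isRelPrime_left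
    intro hmem
    rw [← neg_mul, ← C_neg] at hmem
    have := MvPolynomial.vars_mul _ _ hmem
    rw [vars_C, vars_X, Finset.empty_union, Finset.mem_singleton] at this
    exact hidx this.symm

lemma exists_eval_ax {n : ℕ} {w a b : Fin (2*n)} (hwb : w ≠ b) (hab : a ≠ b) :
    ∃ x : Fin n → ℤ, MvPolynomial.eval x (ax w a) = 0 ∧ MvPolynomial.eval x (ax w b) ≠ 0 := by
  have hs : ∀ k : Fin (2*n), (varSign k : ℤ) = 1 ∨ (varSign k : ℤ) = -1 := fun k => by
    rcases Int.units_eq_one_or (varSign k) with h | h <;> simp [h]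
  have hsq : ∀ k : Fin (2*n), (varSign k : ℤ) * varSign k = 1 := fun k => by
    rcases hs k with h | h <;> simp [h]
  by_cases ha : a = bar w
  · have hb : b ≠ bar w := fun h => hab (ha.trans h.symm)
    have hidx : varIdx b ≠ varIdx w := fun h' =>
      (eq_or_eq_bar_of_varIdx_eq h'.symm).elim (fun e => hwb e.symm) hb
    refine ⟨fun k => if k = varIdx w then 0 else 1, ?_, ?_⟩
    · simp [ax, ha, av_eq]
    · rcases hs b with h | h <;> simp [ax, hb, av_eq, hidx, h]
  · refine ⟨fun k => if k = varIdx w then varSign w else if k = varIdx a then varSign a else 2,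
      ?_, ?_⟩
    · by_cases hidx : varIdx a = varIdx w
      · obtain rfl | h := eq_or_eq_bar_of_varIdx_eq hidx.symm
        · simp [ax, ha]
        · exact absurd h ha
      · simp [ax, ha, av_eq, hidx, hsq]
    · by_cases hb : b = bar w
      · simp [ax, hb, av_eq, hsq]
      · have hidx : varIdx b ≠ varIdx w := fun h' =>
          (eq_or_eq_bar_of_varIdx_eq h'.symm).elim (fun e => hwb e.symm) hb
        by_cases hba : varIdx b = varIdx a
        · obtain h | rfl := eq_or_eq_bar_of_varIdx_eq hba.symm
          · exact absurd h.symm hab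
          · have hidx' : varIdx a ≠ varIdx w := fun h => hidx (hba.trans h)
            simp [ax, hb, av_eq, varIdx_bar, varSign_bar, hidx', hsq]
        · rcases hs b with h | h <;> simp [ax, hb, av_eq, hidx, hba, hsq, h]

lemma isRelPrime_ax {n : ℕ} {w a b : Fin (2*n)} (hwa : w ≠ a) (hwb : w ≠ b) (hab : a ≠ b) :
    IsRelPrime (ax w a) (ax w b) := by
  rw [(irreducible_ax hwa).isRelPrime_iff_not_dvd]
  intro hdvd
  obtain ⟨x, hx0, hx⟩ := exists_eval_ax hwb hab
  have := map_dvd (MvPolynomial.eval x) hdvd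
  rw [hx0, zero_dvd_iff] at this
  exact hx this

lemma prod_ax_dvd_of_vanish {n : ℕ} (f : HGQ n) {A : Finset (Fin (2*n))} {w : Fin (2*n)}
    (hw : w ∉ A) (hf : ∀ a ∈ A, f.1 a = 0) : ∏ a ∈ A, ax w a ∣ f.1 w := by
  have hne : ∀ a ∈ A, w ≠ a := by
    rintro a ha rfl
    exact hw ha
  refine Finset.prod_dvd_of_isRelPrime
    (fun a ha b hb hab => isRelPrime_ax (hne a ha) (hne b hb) hab) fun a ha => ?_
  simpa [hf a ha] using f.2 w a (hne a ha)

/-- The constant functions in the graph equivariant cohomology. -/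
def constHGQ (n : ℕ) : Rr n →+* HGQ n :=
  (Pi.constRingHom (Fin (2*n)) (Rr n)).codRestrict (HGQ n) fun r i j _ => by simp

/-- If `T` lies in `I`, vanishes on `A` and takes the minimal possible value at `w`, then
subtracting a multiple of `T` makes any `f` vanishing on `A` vanish at `w` too. -/
lemma mem_of_vanish_insert {n : ℕ} {I : Ideal (HGQ n)} {A : Finset (Fin (2*n))} {w : Fin (2*n)}
    (hw : w ∉ A) {T : HGQ n} (hTI : T ∈ I) (hTA : ∀ a ∈ A, T.1 a = 0)
    (hTw : T.1 w = ∏ a ∈ A, ax w a)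
    (ih : ∀ f : HGQ n, (∀ a ∈ insert w A, f.1 a = 0) → f ∈ I)
    (f : HGQ n) (hf : ∀ a ∈ A, f.1 a = 0) : f ∈ I := by
  obtain ⟨g, hg⟩ := prod_ax_dvd_of_vanish f hw hf
  have hmem : f - constHGQ n g * T ∈ I := by
    refine ih _ fun a ha => ?_
    have e : (f - constHGQ n g * T).1 a = f.1 a - g * T.1 a := rfl
    rw [e]
    rcases Finset.mem_insert.1 ha with rfl | ha
    · rw [hTw, hg]; ring
    · rw [hf a ha, hTA a ha]; ring
  simpa using I.add_mem hmem (I.mul_mem_left (constHGQ n g) hTI)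

lemma mem_kerIdeal_of_vanish {n : ℕ} {v : Fin (2*n)} {S : Finset (Fin (2*n))}
    (hS : ∀ i, bar i ∈ S ↔ i ∉ S) (A : Finset (Fin (2*n))) (hvA : v ∈ A)
    (hAS : A ⊆ S ∨ S ⊆ A) (f : HGQ n) (hf : ∀ a ∈ A, f.1 a = 0) : f ∈ kerIdeal n v := by
  induction hc : Aᶜ.card generalizing A f with
  | zero =>
    have hA : A = Finset.univ := by simpa using hc
    have : f = 0 := by
      ext1
      funext a
      exact hf a (by simp [hA])
    rw [this]
    exact zero_mem _
  | succ m ih =>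
    have hcard : ∀ w, w ∉ A → (insert w A)ᶜ.card = m := fun w hw => by
      rw [Finset.compl_insert, Finset.card_erase_of_mem (Finset.mem_compl.2 hw), hc]
      rfl
    by_cases hSA : S ⊆ A
    · obtain ⟨w, hw⟩ : Aᶜ.Nonempty := Finset.card_pos.1 (by omega)
      have hP : indep Aᶜ := fun i hi => by
        simp only [Finset.insert_subset_iff, Finset.singleton_subset_iff, Finset.mem_compl] at hi
        exact hi.2 (hSA ((hS i).2 fun h => hi.1 (hSA h)))
      have hw' := Finset.mem_compl.1 hw
      refine mem_of_vanish_insert hw' (T := ⟨Del Aᶜ, Del_mem hP⟩)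
        (Ideal.subset_span (Or.inr ⟨Aᶜ, ⟨w, hw⟩, hP, by simpa using hvA, rfl⟩))
        (fun a ha => by simp [Del, ha]) (by simp [Del, hw'])
        (fun f hf => ih _ (Finset.mem_insert_of_mem hvA)
          (Or.inr (hSA.trans (Finset.subset_insert _ _))) f hf (hcard w hw')) f hf
    · have hAS := hAS.resolve_right hSA
      obtain ⟨w, hwS, hw⟩ := Finset.not_subset.1 hSA
      have hT : ∀ j, (∏ a ∈ A, (⟨Mv a, Mv_mem a⟩ : HGQ n)).1 j = ∏ a ∈ A, Mv a j := fun j => by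
        simp
      refine mem_of_vanish_insert hw (T := ∏ a ∈ A, (⟨Mv a, Mv_mem a⟩ : HGQ n))
        (Ideal.mem_of_dvd _ (Finset.dvd_prod_of_mem _ hvA) (Ideal.subset_span (Or.inl rfl)))
        (fun a ha => ?_) ?_
        (fun f hf => ih _ (Finset.mem_insert_of_mem hvA)
          (Or.inl (Finset.insert_subset hwS hAS)) f hf (hcard w hw)) f hf
      · rw [hT]
        exact Finset.prod_eq_zero ha (by simp [Mv])
      · rw [hT]
        refine Finset.prod_congr rfl fun a ha => ?_
        have hb : a ≠ bar w := by
          rintro rfl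
          exact (hS w).1 (hAS ha) hwS
        rw [Mv_apply, ax, if_neg hb]
        ring

lemma ker_evRing (n : ℕ) (v : Fin (2*n)) : RingHom.ker (evRing n v) = kerIdeal n v := by
  apply le_antisymm
  · intro f hf
    have hf : f.1 v = 0 := hf
    refine mem_kerIdeal_of_vanish (S := Finset.univ.filter fun j => (j.val < n ↔ v.val < n))
      (fun i => ?_) {v} (by simp) (Or.inl (by simp)) f (by simpa using hf)
    simp only [Finset.mem_filter, Finset.mem_univ, true_and, bar_val_lt_iff]
    tauto
  · rw [kerIdeal, Ideal.span_le]
    rintro g (hg | ⟨P, -, -, hv, hg⟩)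
    · change g.1 v = 0
      rw [hg]
      simp [Mv]
    · change g.1 v = 0
      rw [hg]
      simp [Del, hv]

/-- for n ≥ 2 and v ∈ V, ev_v is a surjective ring homomorphism with kernel
the ideal generated by M_v and the Δ_P with v ∉ P; hence the quotient by this ideal is
isomorphic to ℤ[α_1,…,α_n]. -/
theorem stmt12 (n : ℕ) (hn : 2 ≤ n) (v : Fin (2*n)) :
    Function.Surjective (evRing n v) ∧
    RingHom.ker (evRing n v) = kerIdeal n v ∧
    Nonempty ((HGQ n ⧸ kerIdeal n v) ≃+* Rr n) := by
  have hsurj : Function.Surjective (evRing n v) := fun r => ⟨constHGQ n r, rfl⟩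
  exact ⟨hsurj, ker_evRing n v, ⟨(Ideal.quotEquivOfEq (ker_evRing n v).symm).trans
    (RingHom.quotientKerEquivOfSurjective hsurj)⟩⟩

end
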